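/- arXiv:2605.07518 — 5 statements merged into one kernel-verified Lean document; each statement's English description precedes it below -/
import Mathlib

section
/- Let θ ∈ ℝ. Then U_π |φ_θ⟩ = |φ_{2a−θ}⟩, i.e., the diffusion operator maps (sin θ)|good⟩ + (cos θ)|bad⟩ to (sin(2a−θ))|good⟩ + (cos(2a−θ))|bad⟩. -/
open scoped ComplexInnerProductSpace

/-- The reflection about `(sin a) g + (cos a) b` maps the unit vector with angle `θ` in the plane
spanned by the orthonormal pair `g`, `b` to the one with angle `2a − θ`. -/
theorem reflection_sin_cos {E : Type*} [NormedAddCommGroup E] [InnerProductSpace ℂ E]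
    {g b : E} (hg : inner ℂ g g = 1) (hb : inner ℂ b b = 1) (hgb : inner ℂ g b = 0) (a θ : ℝ) :
    (2 * inner ℂ ((Real.sin a : ℂ) • g + (Real.cos a : ℂ) • b)
        ((Real.sin θ : ℂ) • g + (Real.cos θ : ℂ) • b)) •
      ((Real.sin a : ℂ) • g + (Real.cos a : ℂ) • b) -
        ((Real.sin θ : ℂ) • g + (Real.cos θ : ℂ) • b) =
      (Real.sin (2 * a - θ) : ℂ) • g + (Real.cos (2 * a - θ) : ℂ) • b := by
  have hbg : inner ℂ b g = 0 := inner_eq_zero_symm.mp hgb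
  have hinner : inner ℂ ((Real.sin a : ℂ) • g + (Real.cos a : ℂ) • b)
      ((Real.sin θ : ℂ) • g + (Real.cos θ : ℂ) • b) =
      ((Real.sin a * Real.sin θ + Real.cos a * Real.cos θ : ℝ) : ℂ) := by
    simp only [inner_add_left, inner_add_right, inner_smul_left, inner_smul_right, hg, hb, hgb,
      hbg, Complex.conj_ofReal]
    push_cast
    ring
  have hsin : Real.sin (2 * a - θ) =
      2 * (Real.sin a * Real.sin θ + Real.cos a * Real.cos θ) * Real.sin a - Real.sin θ := by
    rw [Real.sin_sub, Real.sin_two_mul, Real.cos_two_mul]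
    linear_combination (-2 * Real.sin θ) * Real.sin_sq_add_cos_sq a
  have hcos : Real.cos (2 * a - θ) =
      2 * (Real.sin a * Real.sin θ + Real.cos a * Real.cos θ) * Real.cos a - Real.cos θ := by
    rw [Real.cos_sub, Real.sin_two_mul, Real.cos_two_mul]
    ring
  rw [hinner, hsin, hcos]
  push_cast
  module

theorem cos_arcsin_inv_sqrt {x : ℝ} (hx : 0 < x) :
    Real.cos (Real.arcsin (Real.sqrt x)⁻¹) = Real.sqrt (x - 1) * (Real.sqrt x)⁻¹ := by
  rw [Real.cos_arcsin, inv_pow, Real.sq_sqrt hx.le, ← div_eq_mul_inv, ← Real.sqrt_div' _ hx.le,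
    sub_div, div_self hx.ne', one_div]

/-- The diffusion operator maps `(sin θ)|good⟩ + (cos θ)|bad⟩` to
`(sin (2a−θ))|good⟩ + (cos (2a−θ))|bad⟩`, where `a = arcsin (1/√N)`. -/
theorem grover_diffusion_reflection (N : ℕ) (hN : 2 ≤ N) (m : Fin N) (θ : ℝ) :
    let e : Fin N → EuclideanSpace ℂ (Fin N) := fun i => EuclideanSpace.single i 1
    let π' : EuclideanSpace ℂ (Fin N) := ((Real.sqrt N)⁻¹ : ℂ) • ∑ i, e i
    let Uπ : EuclideanSpace ℂ (Fin N) → EuclideanSpace ℂ (Fin N) :=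
      fun x => (2 * ⟪π', x⟫) • π' - x
    let a : ℝ := Real.arcsin ((Real.sqrt N)⁻¹)
    let good : EuclideanSpace ℂ (Fin N) := e m
    let bad : EuclideanSpace ℂ (Fin N) :=
      ((Real.sqrt ((N : ℝ) - 1))⁻¹ : ℂ) • ∑ i ∈ Finset.univ.filter (· ≠ m), e i
    let φ : ℝ → EuclideanSpace ℂ (Fin N) :=
      fun θ => (Real.sin θ : ℂ) • good + (Real.cos θ : ℂ) • bad
    Uπ (φ θ) = φ (2 * a - θ) := by
  intro e π' Uπ a good bad φ
  have hN1 : (0 : ℝ) < (N : ℝ) - 1 := by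
    have : (2 : ℝ) ≤ N := by exact_mod_cast hN
    linarith
  have hNpos : (0 : ℝ) < N := by linarith
  have he : Orthonormal ℂ e := EuclideanSpace.orthonormal_single
  have hgood : ⟪good, good⟫ = 1 := by simp [good, inner_self_eq_norm_sq_to_K, he.1 m]
  have horth : ⟪good, bad⟫ = 0 := by
    simp only [good, bad, inner_smul_right, inner_sum]
    rw [Finset.sum_eq_zero, mul_zero]
    intro i hi
    exact he.2 (Finset.mem_filter.mp hi).2.symm
  have hcard : ((Finset.univ.filter (· ≠ m)).card : ℂ) = (((N : ℝ) - 1 : ℝ) : ℂ) := by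
    rw [Finset.filter_ne', Finset.card_erase_of_mem (Finset.mem_univ m), Finset.card_fin,
      Nat.cast_sub (by lia)]
    simp
  have hsqrt : (Real.sqrt ((N : ℝ) - 1) : ℂ) ≠ 0 := by
    exact_mod_cast (Real.sqrt_pos.mpr hN1).ne'
  have hsq : (Real.sqrt ((N : ℝ) - 1) : ℂ) * Real.sqrt ((N : ℝ) - 1) =
      (((N : ℝ) - 1 : ℝ) : ℂ) := by
    rw [← Complex.ofReal_mul, Real.mul_self_sqrt hN1.le]
  have hbad : ⟪bad, bad⟫ = 1 := by
    have hsum := he.inner_sum (fun _ => 1) (fun _ => 1) (Finset.univ.filter (· ≠ m))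
    simp only [one_smul, map_one, mul_one, Finset.sum_const, nsmul_eq_mul] at hsum
    simp only [bad, inner_smul_left, inner_smul_right, map_inv₀, Complex.conj_ofReal]
    rw [hsum, hcard, ← hsq]
    field_simp
  have hsin : Real.sin a = (Real.sqrt N)⁻¹ := by
    refine Real.sin_arcsin (by linarith [inv_nonneg.mpr (Real.sqrt_nonneg (N : ℝ))]) ?_
    exact inv_le_one_of_one_le₀ (Real.one_le_sqrt.mpr (by linarith))
  have hπ : π' = (Real.sin a : ℂ) • good + (Real.cos a : ℂ) • bad := by
    have hcos : Real.cos a = Real.sqrt ((N : ℝ) - 1) * (Real.sqrt N)⁻¹ :=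
      cos_arcsin_inv_sqrt hNpos
    have hcoef : (Real.cos a : ℂ) * (Real.sqrt ((N : ℝ) - 1) : ℂ)⁻¹ = (Real.sqrt N : ℂ)⁻¹ := by
      rw [hcos, Complex.ofReal_mul, Complex.ofReal_inv]
      field_simp
    simp only [π', bad, good]
    rw [smul_smul, hcoef, hsin, Complex.ofReal_inv, ← smul_add, Finset.filter_ne',
      Finset.add_sum_erase _ _ (Finset.mem_univ m)]
  simp only [Uπ, φ, hπ]
  exact reflection_sin_cos hgood hbad horth a θ
end

section
/- For every natural number T, (U_π U_f)^T |π⟩ = sin((2T+1)a)|good⟩ + cos((2T+1)a)|bad⟩. -/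
open scoped ComplexInnerProductSpace

section Plane

variable {E : Type*} [NormedAddCommGroup E] [InnerProductSpace ℂ E]

/-- The vector at angle `θ` from `b` towards `g` in the real plane spanned by `g` and `b`. -/
noncomputable def planeVector (g b : E) (θ : ℝ) : E :=
  (Real.sin θ : ℂ) • g + (Real.cos θ : ℂ) • b

variable {g b : E}

lemma inner_left_planeVector (hg : ⟪g, g⟫ = 1) (hgb : ⟪g, b⟫ = 0) (θ : ℝ) :
    ⟪g, planeVector g b θ⟫ = Real.sin θ := by
  simp only [planeVector, inner_add_right, inner_smul_right, hg, hgb, mul_one, mul_zero, add_zero]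

lemma inner_planeVector_planeVector (hg : ⟪g, g⟫ = 1) (hb : ⟪b, b⟫ = 1) (hgb : ⟪g, b⟫ = 0)
    (α θ : ℝ) : ⟪planeVector g b α, planeVector g b θ⟫ = Real.cos (α - θ) := by
  have hbg : ⟪b, g⟫ = 0 := inner_eq_zero_symm.mp hgb
  simp only [planeVector, inner_add_left, inner_add_right, inner_smul_left, inner_smul_right,
    hg, hb, hgb, hbg, Complex.conj_ofReal, Real.cos_sub]
  push_cast
  ring

lemma planeVector_sub_two_inner_smul (hg : ⟪g, g⟫ = 1) (hgb : ⟪g, b⟫ = 0) (θ : ℝ) :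
    planeVector g b θ - (2 * ⟪g, planeVector g b θ⟫) • g = planeVector g b (-θ) := by
  rw [inner_left_planeVector hg hgb]
  simp only [planeVector, Real.sin_neg, Real.cos_neg, Complex.ofReal_neg]
  module

lemma two_inner_smul_planeVector_sub (hg : ⟪g, g⟫ = 1) (hb : ⟪b, b⟫ = 1) (hgb : ⟪g, b⟫ = 0)
    (α θ : ℝ) :
    (2 * ⟪planeVector g b α, planeVector g b θ⟫) • planeVector g b α - planeVector g b θ =
      planeVector g b (2 * α - θ) := by
  rw [inner_planeVector_planeVector hg hb hgb]
  have hs : Real.sin (2 * α - θ) = 2 * Real.cos (α - θ) * Real.sin α - Real.sin θ := by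
    have h := Real.sin_sub α (α - θ)
    rw [sub_sub_cancel] at h
    rw [show 2 * α - θ = α + (α - θ) by ring, Real.sin_add, h]
    ring
  have hc : Real.cos (2 * α - θ) = 2 * Real.cos (α - θ) * Real.cos α - Real.cos θ := by
    have h := Real.cos_sub α (α - θ)
    rw [sub_sub_cancel] at h
    rw [show 2 * α - θ = α + (α - θ) by ring, Real.cos_add, h]
    ring
  simp only [planeVector, hs, hc]
  push_cast
  module

end Plane

/-- After `T` Grover iterations,
`(U_π U_f)^T |π⟩ = sin ((2T+1)a)|good⟩ + cos ((2T+1)a)|bad⟩`. -/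
theorem grover_iterated_state (N : ℕ) (hN : 2 ≤ N) (m : Fin N) (T : ℕ) :
    let e : Fin N → EuclideanSpace ℂ (Fin N) := fun i => EuclideanSpace.single i 1
    let π' : EuclideanSpace ℂ (Fin N) := ((Real.sqrt N)⁻¹ : ℂ) • ∑ i, e i
    let Uf : EuclideanSpace ℂ (Fin N) → EuclideanSpace ℂ (Fin N) :=
      fun x => x - (2 * ⟪e m, x⟫) • e m
    let Uπ : EuclideanSpace ℂ (Fin N) → EuclideanSpace ℂ (Fin N) :=
      fun x => (2 * ⟪π', x⟫) • π' - x
    let a : ℝ := Real.arcsin ((Real.sqrt N)⁻¹)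
    let good : EuclideanSpace ℂ (Fin N) := e m
    let bad : EuclideanSpace ℂ (Fin N) :=
      ((Real.sqrt ((N : ℝ) - 1))⁻¹ : ℂ) • ∑ i ∈ Finset.univ.filter (· ≠ m), e i
    (Uπ ∘ Uf)^[T] π' =
      (Real.sin ((2 * (T : ℝ) + 1) * a) : ℂ) • good +
        (Real.cos ((2 * (T : ℝ) + 1) * a) : ℂ) • bad := by
  intro e π' Uf Uπ a good bad
  have hN1 : (0 : ℝ) < (N : ℝ) - 1 := by
    have : (2 : ℝ) ≤ N := by exact_mod_cast hN
    linarith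
  have hN0 : (0 : ℝ) < N := by linarith
  have he (i j : Fin N) : ⟪e i, e j⟫ = if i = j then (1 : ℂ) else 0 := by
    simp [e, EuclideanSpace.inner_single_left]
  have hg : ⟪good, good⟫ = (1 : ℂ) := by rw [he, if_pos rfl]
  have hgb : ⟪good, bad⟫ = (0 : ℂ) := by
    simp [good, bad, he]
  have hcard : ((Finset.univ.filter (· ≠ m)).card : ℂ) = (((N : ℝ) - 1 : ℝ) : ℂ) := by
    rw [Finset.filter_ne', Finset.card_erase_of_mem (Finset.mem_univ m), Finset.card_univ,
      Fintype.card_fin, Nat.cast_sub (by omega)]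
    simp
  have hsqrt : ((Real.sqrt ((N : ℝ) - 1) : ℝ) : ℂ) ≠ 0 := by
    exact_mod_cast (Real.sqrt_pos.mpr hN1).ne'
  have hb : ⟪bad, bad⟫ = (1 : ℂ) := by
    have hsum : ⟪∑ i ∈ Finset.univ.filter (· ≠ m), e i, ∑ i ∈ Finset.univ.filter (· ≠ m), e i⟫ =
        (((N : ℝ) - 1 : ℝ) : ℂ) := by
      rw [← hcard, sum_inner, Finset.card_eq_sum_ones, Nat.cast_sum]
      refine Finset.sum_congr rfl fun i hi => ?_
      simp only [inner_sum, he, Finset.sum_ite_eq, if_pos hi, Nat.cast_one]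
    have hsq : (((N : ℝ) - 1 : ℝ) : ℂ) = (Real.sqrt ((N : ℝ) - 1) : ℂ) ^ 2 := by
      exact_mod_cast (Real.sq_sqrt hN1.le).symm
    simp only [bad]
    rw [inner_smul_left, inner_smul_right, hsum, map_inv₀, Complex.conj_ofReal, hsq]
    field_simp
  have hsin : Real.sin a = (Real.sqrt N)⁻¹ := by
    have h1 : (Real.sqrt N)⁻¹ ≤ 1 := inv_le_one_of_one_le₀ (Real.one_le_sqrt.mpr (by linarith))
    have h0 : 0 ≤ (Real.sqrt N)⁻¹ := by positivity
    exact Real.sin_arcsin (by linarith) h1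
  have hcos : Real.cos a = (Real.sqrt N)⁻¹ * Real.sqrt ((N : ℝ) - 1) := by
    rw [Real.cos_arcsin, inv_pow, Real.sq_sqrt hN0.le, ← Real.sqrt_inv,
      ← Real.sqrt_mul (by positivity)]
    congr 1
    field_simp
  have hπ : π' = planeVector good bad a := by
    have hsplit : ∑ i, e i = e m + ∑ i ∈ Finset.univ.filter (· ≠ m), e i := by
      rw [Finset.filter_ne', Finset.add_sum_erase _ _ (Finset.mem_univ m)]
    simp only [π', planeVector, good, bad, hsplit, hsin, hcos, smul_add, smul_smul]
    push_cast
    rw [mul_assoc, mul_inv_cancel₀ hsqrt, mul_one]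
  have hstep (θ : ℝ) : (Uπ ∘ Uf) (planeVector good bad θ) = planeVector good bad (θ + 2 * a) := by
    have hf : Uf (planeVector good bad θ) = planeVector good bad (-θ) :=
      planeVector_sub_two_inner_smul hg hgb θ
    simp only [Function.comp_apply, hf, Uπ, hπ]
    rw [two_inner_smul_planeVector_sub hg hb hgb, sub_neg_eq_add, add_comm]
  suffices h : (Uπ ∘ Uf)^[T] π' = planeVector good bad ((2 * (T : ℝ) + 1) * a) from h
  induction T with
  | zero => simpa using hπ
  | succ T ih =>
    rw [Function.iterate_succ_apply', ih, hstep]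
    congr 1
    push_cast
    ring
end

section
/- There exists a constant C > 0 such that for every natural number N ≥ 2 the following holds: with a = arcsin(1/√N) and T the nearest integer to (π/4)√N, one has π/2 ≤ (2T+1)·a ≤ π/2 + C/√N. -/
theorem le_arcsin_self {x : ℝ} (hx : 0 ≤ x) (hx1 : x ≤ 1) : x ≤ Real.arcsin x := by
  have h := Real.sin_le (Real.arcsin_nonneg.2 hx)
  rwa [Real.sin_arcsin (by linarith) hx1] at h

theorem arcsin_le_two_mul {x : ℝ} (hx : 0 ≤ x) (hx1 : x ≤ 1) : Real.arcsin x ≤ 2 * x := by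
  have h := Real.mul_le_sin (Real.arcsin_nonneg.2 hx) (Real.arcsin_le_pi_div_two x)
  rw [Real.sin_arcsin (by linarith) hx1, div_mul_eq_mul_div, div_le_iff₀ Real.pi_pos] at h
  nlinarith [Real.pi_le_four]

/-- A quadratic upper bound for `Real.arcsin` on the unit interval. -/
theorem arcsin_le_add_two_mul_sq {x : ℝ} (hx : 0 ≤ x) (hx1 : x ≤ 1) :
    Real.arcsin x ≤ x + 2 * x ^ 2 := by
  have h0 : 0 ≤ Real.arcsin x := Real.arcsin_nonneg.2 hx
  have h := Real.sin_ge_sub_cube h0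
  rw [Real.sin_arcsin (by linarith) hx1] at h
  have h3 : Real.arcsin x ^ 3 ≤ (2 * x) ^ 3 :=
    pow_le_pow_left₀ h0 (arcsin_le_two_mul hx hx1) 3
  nlinarith [mul_nonneg (sq_nonneg x) (sub_nonneg.2 hx1), sq_nonneg x]

/-- There is a constant `C > 0` such that for all `N ≥ 2`, with
`a = arcsin (1/√N)` and `T = ⌊(π/4)√N + 1/2⌋` the nearest integer to `(π/4)√N`,
one has `π/2 ≤ (2T+1)·a ≤ π/2 + C/√N`. -/
theorem grover_angle_close_to_pi_div_two :
    ∃ C : ℝ, 0 < C ∧ ∀ N : ℕ, 2 ≤ N →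
      let a : ℝ := Real.arcsin ((Real.sqrt N)⁻¹)
      let T : ℤ := ⌊(Real.pi / 4) * Real.sqrt N + 1 / 2⌋
      Real.pi / 2 ≤ (2 * (T : ℝ) + 1) * a ∧
        (2 * (T : ℝ) + 1) * a ≤ Real.pi / 2 + C / Real.sqrt N := by
  refine ⟨10, by norm_num, fun N hN => ?_⟩
  intro a T
  have hs : 1 ≤ Real.sqrt N := Real.one_le_sqrt.2 (by exact_mod_cast (by omega : 1 ≤ N))
  have hs0 : 0 < Real.sqrt N := by linarith
  have hT1 : Real.pi / 4 * Real.sqrt N + 1 / 2 < T + 1 := Int.lt_floor_add_one _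
  have hT2 : (T : ℝ) ≤ Real.pi / 4 * Real.sqrt N + 1 / 2 := Int.floor_le _
  rw [div_eq_mul_inv 10]
  set x := (Real.sqrt N)⁻¹
  have hx : 0 < x := inv_pos.2 hs0
  have hx1 : x ≤ 1 := inv_le_one_of_one_le₀ hs
  have hsx : Real.sqrt N * x = 1 := mul_inv_cancel₀ hs0.ne'
  have ha1 : x ≤ a := le_arcsin_self hx.le hx1
  have ha2 : a ≤ x + 2 * x ^ 2 := arcsin_le_add_two_mul_sq hx.le hx1
  have hpi := Real.pi_pos
  constructor
  · calc Real.pi / 2 = (Real.pi / 2 * Real.sqrt N) * x := by rw [mul_assoc, hsx, mul_one]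
      _ ≤ (2 * (T : ℝ) + 1) * a :=
        mul_le_mul (by linarith) ha1 hx.le (by nlinarith [mul_pos hpi hs0])
  · calc (2 * (T : ℝ) + 1) * a
        ≤ (Real.pi / 2 * Real.sqrt N + 2) * (x + 2 * x ^ 2) :=
          mul_le_mul (by linarith) ha2 (by linarith) (by positivity)
      _ = Real.pi / 2 * (Real.sqrt N * x) * (1 + 2 * x) + 2 * x + 4 * x ^ 2 := by ring
      _ ≤ Real.pi / 2 + 10 * x := by
        rw [hsx]
        nlinarith [mul_nonneg hx.le (sub_nonneg.2 hx1),
          mul_nonneg hx.le (sub_nonneg.2 Real.pi_le_four)]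
end

section
/- (Correctness of Grover's algorithm with a unique marked element.) There exists a constant C > 0 such that for every natural number N ≥ 2 and every m ∈ Fin N the following holds: with T the nearest integer to (π/4)√N, the amplitude of the marked element after T Grover iterations satisfies |⟨e_m, (U_π U_f)^T |π⟩⟩|² ≥ 1 − C/N. -/
open scoped ComplexInnerProductSpace

/-- In the plane spanned by two unit vectors `u`, `p` with `⟪u, p⟫ = sin a`, the Grover iteration
acts as a rotation by `2 a`. -/
theorem inner_grover_iterate {E : Type*} [NormedAddCommGroup E] [InnerProductSpace ℂ E]
    {u p : E} {a : ℝ} (hu : ‖u‖ = 1) (hp : ‖p‖ = 1) (hup : ⟪u, p⟫ = (Real.sin a : ℂ)) (k : ℕ) :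
    ⟪u, ((fun x => (2 * ⟪p, x⟫) • p - x) ∘ fun x => x - (2 * ⟪u, x⟫) • u)^[k] p⟫ =
        (Real.sin ((2 * k + 1) * a) : ℂ) ∧
      ⟪p, ((fun x => (2 * ⟪p, x⟫) • p - x) ∘ fun x => x - (2 * ⟪u, x⟫) • u)^[k] p⟫ =
        (Real.cos (2 * k * a) : ℂ) := by
  have hpu : ⟪p, u⟫ = (Real.sin a : ℂ) := by
    rw [← inner_conj_symm, hup, Complex.conj_ofReal]
  have huu : ⟪u, u⟫ = 1 := by simp [inner_self_eq_norm_sq_to_K, hu]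
  have hpp : ⟪p, p⟫ = 1 := by simp [inner_self_eq_norm_sq_to_K, hp]
  induction k with
  | zero => simp [hup, hp]
  | succ k ih =>
    obtain ⟨ihu, ihp⟩ := ih
    rw [Function.iterate_succ_apply']
    generalize ((fun x => (2 * ⟪p, x⟫) • p - x) ∘ fun x => x - (2 * ⟪u, x⟫) • u)^[k] p = x at *
    have hcos : Real.cos (2 * ((k + 1 : ℕ) : ℝ) * a) =
        Real.cos (2 * k * a) - 2 * Real.sin a * Real.sin ((2 * k + 1) * a) := by
      rw [show 2 * ((k + 1 : ℕ) : ℝ) * a = (2 * k + 1) * a + a by push_cast; ring,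
        show 2 * (k : ℝ) * a = (2 * k + 1) * a - a by ring, Real.cos_add, Real.cos_sub]
      ring
    have hsin : Real.sin ((2 * ((k + 1 : ℕ) : ℝ) + 1) * a) =
        2 * Real.sin a * Real.cos (2 * ((k + 1 : ℕ) : ℝ) * a) + Real.sin ((2 * k + 1) * a) := by
      rw [show (2 * ((k + 1 : ℕ) : ℝ) + 1) * a = 2 * ((k + 1 : ℕ) : ℝ) * a + a by ring,
        show (2 * (k : ℝ) + 1) * a = 2 * ((k + 1 : ℕ) : ℝ) * a - a by push_cast; ring,
        Real.sin_add, Real.sin_sub]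
      ring
    rw [hsin, hcos]
    simp only [Function.comp_apply, inner_sub_right, inner_smul_right, hup, hpu, huu, hpp, ihu, ihp,
      Complex.ofReal_add, Complex.ofReal_sub, Complex.ofReal_mul, Complex.ofReal_ofNat]
    constructor <;> ring

/-- After the optimal number of steps the angle is within `4 / r` of `π / 2`. -/
theorem one_sub_le_sin_sq_grover_angle {r : ℝ} (hr : 10 ≤ r) :
    1 - 16 / r ^ 2 ≤
      Real.sin ((2 * (⌊Real.pi / 4 * r + 1 / 2⌋.toNat : ℝ) + 1) * Real.arcsin r⁻¹) ^ 2 := by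
  have hπ := Real.pi_pos
  have hπ' : Real.pi < 3.15 := Real.pi_lt_d2
  have hr0 : 0 < r := by linarith
  set T := ⌊Real.pi / 4 * r + 1 / 2⌋.toNat
  set s := r⁻¹ with hs
  set a := Real.arcsin s
  have hrs : r * s = 1 := mul_inv_cancel₀ hr0.ne'
  have hs0 : 0 < s := inv_pos.mpr hr0
  have hs1 : s ≤ 1 / 10 := by nlinarith
  have hTfloor : (T : ℤ) = ⌊Real.pi / 4 * r + 1 / 2⌋ :=
    Int.toNat_of_nonneg (Int.floor_nonneg.mpr (by positivity))
  have hTcast : (T : ℝ) = (⌊Real.pi / 4 * r + 1 / 2⌋ : ℝ) := by exact_mod_cast hTfloor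
  have hT_le : (T : ℝ) ≤ Real.pi / 4 * r + 1 / 2 := hTcast ▸ Int.floor_le _
  have hT_lt : Real.pi / 4 * r + 1 / 2 < T + 1 := hTcast ▸ Int.lt_floor_add_one _
  have hsin : Real.sin a = s := Real.sin_arcsin (by linarith) (by linarith)
  have ha0 : 0 < a := Real.arcsin_pos.mpr hs0
  have hsa : s ≤ a := hsin ▸ Real.sin_le ha0.le
  have has : a ≤ 1.6 * s := by
    have h := Real.mul_le_sin ha0.le (Real.arcsin_le_pi_div_two s)
    rw [hsin, div_mul_eq_mul_div, div_le_iff₀ hπ] at h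
    nlinarith
  have hcube : a - s ≤ 0.11 * s ^ 2 := by
    have h := Real.sin_gt_sub_cube ha0
    have h3 : a ^ 3 ≤ (1.6 * s) ^ 3 := pow_le_pow_left₀ ha0.le has 3
    rw [hsin] at h
    nlinarith [mul_le_mul_of_nonneg_left hs1 (sq_nonneg s)]
  have hra : r * a ≤ 1 + 0.11 * s := by
    have h := mul_le_mul_of_nonneg_left hcube hr0.le
    have h2 : r * (0.11 * s ^ 2) = 0.11 * s * (r * s) := by ring
    rw [h2, hrs] at h
    linarith [mul_sub r a s]
  have hra' : 1 ≤ r * a := hrs ▸ mul_le_mul_of_nonneg_left hsa hr0.le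
  set d := (2 * (T : ℝ) + 1) * a - Real.pi / 2 with hd
  have hd0 : 0 ≤ d := by
    have h := mul_le_mul_of_nonneg_right
      (show Real.pi / 2 * r ≤ 2 * (T : ℝ) + 1 by linarith) ha0.le
    nlinarith
  have hd4 : d ≤ 4 * s := by
    have h := mul_le_mul_of_nonneg_right
      (show 2 * (T : ℝ) + 1 ≤ Real.pi / 2 * r + 2 by linarith) ha0.le
    have h2 := mul_le_mul_of_nonneg_left hra (show 0 ≤ Real.pi / 2 by positivity)
    nlinarith
  have hcos : Real.sin ((2 * (T : ℝ) + 1) * a) = Real.cos d := by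
    rw [hd, Real.cos_sub_pi_div_two]
  have hsd : Real.sin d ^ 2 ≤ d ^ 2 := Real.sin_sq_le_sq
  have hds : d ^ 2 ≤ (4 * s) ^ 2 := pow_le_pow_left₀ hd0 hd4 2
  have hsr : 16 / r ^ 2 = (4 * s) ^ 2 := by rw [hs]; field_simp; norm_num
  rw [hcos, Real.cos_sq', hsr]
  linarith

/-- correctness of Grover's algorithm with a unique marked element:
there is a constant `C > 0` such that for all `N ≥ 2` and all `m`, with
`T = ⌊(π/4)√N + 1/2⌋` the nearest integer to `(π/4)√N`, the success amplitude satisfies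
`|⟨e_m, (U_π U_f)^T |π⟩⟩|² ≥ 1 − C/N`. -/
theorem grover_correctness :
    ∃ C : ℝ, 0 < C ∧ ∀ N : ℕ, 2 ≤ N → ∀ m : Fin N,
      let e : Fin N → EuclideanSpace ℂ (Fin N) := fun i => EuclideanSpace.single i 1
      let π' : EuclideanSpace ℂ (Fin N) := ((Real.sqrt N)⁻¹ : ℂ) • ∑ i, e i
      let Uf : EuclideanSpace ℂ (Fin N) → EuclideanSpace ℂ (Fin N) :=
        fun x => x - (2 * ⟪e m, x⟫) • e m
      let Uπ : EuclideanSpace ℂ (Fin N) → EuclideanSpace ℂ (Fin N) :=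
        fun x => (2 * ⟪π', x⟫) • π' - x
      let T : ℕ := (⌊(Real.pi / 4) * Real.sqrt N + 1 / 2⌋).toNat
      1 - C / (N : ℝ) ≤ ‖⟪e m, (Uπ ∘ Uf)^[T] π'⟫‖ ^ 2 := by
  refine ⟨100, by norm_num, fun N hN m => ?_⟩
  intro e π' Uf Uπ T
  have hN0 : (0 : ℝ) < N := by positivity
  rcases le_or_gt (N : ℝ) 100 with h100 | h100
  · have h : 1 ≤ 100 / (N : ℝ) := (one_le_div hN0).mpr h100
    linarith [sq_nonneg ‖⟪e m, (Uπ ∘ Uf)^[T] π'⟫‖]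
  have hr : 10 ≤ Real.sqrt N := Real.le_sqrt_of_sq_le (by linarith)
  have hr0 : 0 < Real.sqrt N := by linarith
  have hr1 : (Real.sqrt N)⁻¹ ≤ 1 := inv_le_one_of_one_le₀ (by linarith)
  have hsq : Real.sqrt N ^ 2 = N := Real.sq_sqrt hN0.le
  have hcoord (i : Fin N) : π' i = ((Real.sqrt N)⁻¹ : ℂ) := by
    simp [π', e, Finset.sum_apply]
  have he : ‖e m‖ = 1 := by simp [e]
  have hπ' : ‖π'‖ = 1 := by
    rw [EuclideanSpace.norm_eq, Real.sqrt_eq_one]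
    simp [hcoord, hsq, hN0.ne']
  have heπ : ⟪e m, π'⟫ = (Real.sin (Real.arcsin (Real.sqrt N)⁻¹) : ℂ) := by
    rw [Real.sin_arcsin (by linarith [inv_pos.mpr hr0]) hr1]
    simp [e, EuclideanSpace.inner_single_left, hcoord]
  have hiter : ⟪e m, (Uπ ∘ Uf)^[T] π'⟫ = _ := (inner_grover_iterate he hπ' heπ T).1
  have hmain := one_sub_le_sin_sq_grover_angle hr
  rw [hsq] at hmain
  rw [hiter, Complex.norm_real, Real.norm_eq_abs, sq_abs]
  refine le_trans ?_ hmain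
  gcongr
  norm_num
end

section
/- (Query weights in Grover's algorithm.) For every integer t ≥ 1, the state |ψ_t⟩ = (U_π U_f)^{t−1}|π⟩ just before the t-th oracle query satisfies: |⟨e_m, ψ_t⟩|² = sin²((2t−1)a), and for every i ≠ m, |⟨e_i, ψ_t⟩|² = cos²((2t−1)a)/(N−1). -/
open scoped ComplexInnerProductSpace

/-- The unit vector at angle `θ` in the real plane spanned by the marked basis vector `e_m` and the
normalised sum of the unmarked ones, with `θ` measured towards `e_m`. -/
noncomputable def groverState {N : ℕ} (m : Fin N) (θ : ℝ) : EuclideanSpace ℂ (Fin N) :=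
  WithLp.toLp 2 fun i => if i = m then (Real.sin θ : ℂ) else ((Real.cos θ / √((N : ℝ) - 1) : ℝ) : ℂ)

@[simp]
lemma groverState_marked {N : ℕ} (m : Fin N) (θ : ℝ) : groverState m θ m = Real.sin θ := by
  simp [groverState]

lemma groverState_of_ne {N : ℕ} {m i : Fin N} (h : i ≠ m) (θ : ℝ) :
    groverState m θ i = ((Real.cos θ / √((N : ℝ) - 1) : ℝ) : ℂ) := by
  simp [groverState, h]

lemma inner_groverState {N : ℕ} (hN : 2 ≤ N) (m : Fin N) (α β : ℝ) :
    ⟪groverState m α, groverState m β⟫ = Real.cos (α - β) := by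
  have hN' : (0 : ℝ) < (N : ℝ) - 1 := by
    have : (2 : ℝ) ≤ N := by exact_mod_cast hN
    linarith
  have hs : √((N : ℝ) - 1) * √((N : ℝ) - 1) = (N : ℝ) - 1 := Real.mul_self_sqrt hN'.le
  have hs0 : √((N : ℝ) - 1) ≠ 0 := (Real.sqrt_pos.2 hN').ne'
  have hunmarked : ∑ i ∈ Finset.univ.erase m, ⟪groverState m α i, groverState m β i⟫ =
      ((Real.cos α * Real.cos β : ℝ) : ℂ) := by
    rw [Finset.sum_congr rfl (g := fun _ => ((Real.cos α * Real.cos β / ((N : ℝ) - 1) : ℝ) : ℂ))]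
    · rw [Finset.sum_const, Finset.card_erase_of_mem (Finset.mem_univ m), Finset.card_univ,
        Fintype.card_fin, nsmul_eq_mul, Nat.cast_sub (by lia), ← Complex.ofReal_natCast,
        Nat.cast_one, ← Complex.ofReal_one, ← Complex.ofReal_sub, ← Complex.ofReal_mul]
      congr 1
      field_simp
    · intro i hi
      rw [groverState_of_ne (Finset.ne_of_mem_erase hi), groverState_of_ne
        (Finset.ne_of_mem_erase hi), RCLike.inner_apply, Complex.conj_ofReal, ← Complex.ofReal_mul,
        div_mul_div_comm, hs, mul_comm (Real.cos β)]
  rw [PiLp.inner_apply, ← Finset.add_sum_erase _ _ (Finset.mem_univ m), hunmarked,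
    groverState_marked, groverState_marked, RCLike.inner_apply, Complex.conj_ofReal, Real.cos_sub]
  push_cast
  ring

lemma groverState_oracle {N : ℕ} (m : Fin N) (θ : ℝ) :
    groverState m θ - (2 * ⟪EuclideanSpace.single m (1 : ℂ), groverState m θ⟫) •
      EuclideanSpace.single m (1 : ℂ) = groverState m (-θ) := by
  ext i
  by_cases h : i = m
  · subst h
    simp [EuclideanSpace.inner_single_left]
    ring
  · simp [h, groverState_of_ne h]

lemma groverState_diffusion {N : ℕ} (hN : 2 ≤ N) (m : Fin N) (a θ : ℝ) :
    (2 * ⟪groverState m a, groverState m θ⟫) • groverState m a - groverState m θ =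
      groverState m (2 * a - θ) := by
  have hsin : Real.sin (2 * a - θ) = 2 * Real.cos (a - θ) * Real.sin a - Real.sin θ := by
    rw [Real.sin_sub, Real.cos_sub, Real.sin_two_mul, Real.cos_two_mul']
    linear_combination (-Real.sin θ) * Real.sin_sq_add_cos_sq a
  have hcos : Real.cos (2 * a - θ) = 2 * Real.cos (a - θ) * Real.cos a - Real.cos θ := by
    rw [Real.cos_sub, Real.cos_sub, Real.sin_two_mul, Real.cos_two_mul]
    ring
  rw [inner_groverState hN]
  ext i
  by_cases h : i = m
  · subst h
    simp only [PiLp.sub_apply, PiLp.smul_apply, groverState_marked, smul_eq_mul, hsin]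
    push_cast
    ring
  · simp only [PiLp.sub_apply, PiLp.smul_apply, groverState_of_ne h, smul_eq_mul, hcos]
    push_cast
    ring

lemma uniform_eq_groverState {N : ℕ} (hN : 2 ≤ N) (m : Fin N) :
    ((√(N : ℝ) : ℂ)⁻¹) • ∑ i : Fin N, EuclideanSpace.single i (1 : ℂ) =
      groverState m (Real.arcsin (√(N : ℝ))⁻¹) := by
  have hN' : (2 : ℝ) ≤ N := by exact_mod_cast hN
  have hsqrt : 1 ≤ √(N : ℝ) := Real.one_le_sqrt.2 (by linarith)
  have hsin : Real.sin (Real.arcsin (√(N : ℝ))⁻¹) = (√(N : ℝ))⁻¹ :=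
    Real.sin_arcsin (by linarith [inv_nonneg.2 (Real.sqrt_nonneg (N : ℝ))])
      (inv_le_one_of_one_le₀ hsqrt)
  have hcos : Real.cos (Real.arcsin (√(N : ℝ))⁻¹) / √((N : ℝ) - 1) = (√(N : ℝ))⁻¹ := by
    have h1 : 1 - (√(N : ℝ))⁻¹ ^ 2 = ((N : ℝ) - 1) / N := by
      rw [inv_pow, Real.sq_sqrt (by linarith)]
      field_simp
    have h2 : √((N : ℝ) - 1) ≠ 0 := (Real.sqrt_pos.2 (by linarith)).ne'
    rw [Real.cos_arcsin, h1, Real.sqrt_div (by linarith)]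
    field_simp
  ext i
  have hi : ((√(N : ℝ) : ℂ)⁻¹ • ∑ j : Fin N, EuclideanSpace.single j (1 : ℂ)) i =
      (((√(N : ℝ))⁻¹ : ℝ) : ℂ) := by
    simp [Pi.single_apply]
  rw [hi]
  by_cases h : i = m
  · rw [h, groverState_marked, hsin]
  · rw [groverState_of_ne h, hcos]

/-- query weights in Grover's algorithm: for every `t ≥ 1`, the state
`|ψ_t⟩ = (U_π U_f)^{t−1}|π⟩` just before the `t`-th oracle query satisfies
`|⟨e_m, ψ_t⟩|² = sin²((2t−1)a)` and `|⟨e_i, ψ_t⟩|² = cos²((2t−1)a)/(N−1)` for `i ≠ m`. -/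
theorem grover_query_weights (N : ℕ) (hN : 2 ≤ N) (m : Fin N) (t : ℕ) (ht : 1 ≤ t) :
    let e : Fin N → EuclideanSpace ℂ (Fin N) := fun i => EuclideanSpace.single i 1
    let π' : EuclideanSpace ℂ (Fin N) := ((Real.sqrt N)⁻¹ : ℂ) • ∑ i, e i
    let Uf : EuclideanSpace ℂ (Fin N) → EuclideanSpace ℂ (Fin N) :=
      fun x => x - (2 * ⟪e m, x⟫) • e m
    let Uπ : EuclideanSpace ℂ (Fin N) → EuclideanSpace ℂ (Fin N) :=
      fun x => (2 * ⟪π', x⟫) • π' - x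
    let a : ℝ := Real.arcsin ((Real.sqrt N)⁻¹)
    let ψ : EuclideanSpace ℂ (Fin N) := (Uπ ∘ Uf)^[t - 1] π'
    ‖⟪e m, ψ⟫‖ ^ 2 = Real.sin ((2 * (t : ℝ) - 1) * a) ^ 2 ∧
      ∀ i : Fin N, i ≠ m →
        ‖⟪e i, ψ⟫‖ ^ 2 = Real.cos ((2 * (t : ℝ) - 1) * a) ^ 2 / ((N : ℝ) - 1) := by
  intro e π' Uf Uπ a ψ
  have hπ : π' = groverState m a := uniform_eq_groverState hN m
  have hstep (θ : ℝ) : (Uπ ∘ Uf) (groverState m θ) = groverState m (θ + 2 * a) := by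
    simp only [Function.comp_apply, Uf, Uπ, e, hπ]
    rw [groverState_oracle, groverState_diffusion hN]
    congr 1
    ring
  have hiter (k : ℕ) : (Uπ ∘ Uf)^[k] π' = groverState m ((2 * k + 1) * a) := by
    induction k with
    | zero => simp [hπ]
    | succ k ih =>
      rw [Function.iterate_succ_apply', ih, hstep]
      congr 1
      push_cast
      ring
  have hψ : ψ = groverState m ((2 * (t : ℝ) - 1) * a) := by
    simp only [ψ, hiter]
    congr 2
    rw [Nat.cast_sub ht]
    ring
  have hinner (i : Fin N) : ⟪e i, ψ⟫ = ψ i := by simp [e, EuclideanSpace.inner_single_left]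
  refine ⟨?_, fun i hi => ?_⟩
  · rw [hinner, hψ, groverState_marked, Complex.norm_real, Real.norm_eq_abs, sq_abs]
  · have hN' : (1 : ℝ) ≤ N := by exact_mod_cast (by lia : 1 ≤ N)
    rw [hinner, hψ, groverState_of_ne hi, Complex.norm_real, Real.norm_eq_abs, sq_abs, div_pow,
      Real.sq_sqrt (by linarith)]
end
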